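/- Let G = (V, E) be a finite τ-critical simple graph with transversal number τ(G) = t. Then |E| ≤ (t+1 choose 2). -/

import Mathlib

open SimpleGraph

/-- A transversal set (vertex cover): a set of vertices meeting every edge. -/
def IsTransversal {V : Type*} (G : SimpleGraph V) (S : Set V) : Prop :=
  ∀ ⦃u v : V⦄, G.Adj u v → u ∈ S ∨ v ∈ S

/-- The transversal number: minimum cardinality of a transversal set. -/
noncomputable def tau {V : Type*} [Fintype V] (G : SimpleGraph V) : ℕ :=
  sInf {n | ∃ S : Finset V, IsTransversal G ↑S ∧ S.card = n}

/-- A graph with no isolated vertices is τ-critical if deleting any edge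
decreases the transversal number by one. -/
def TauCritical {V : Type*} [Fintype V] (G : SimpleGraph V) : Prop :=
  (∀ v : V, ∃ u, G.Adj v u) ∧
  ∀ e ∈ G.edgeSet, tau (G.deleteEdges {e}) = tau G - 1

/-- The identity behind the averaging step in Bollobás's inequality. -/
lemma mul_inv_choose_add_pred (a b : ℕ) (hb : 0 < b) :
    (b : ℚ) * ((a + (b - 1)).choose a : ℚ)⁻¹ = (a + b) * ((a + b).choose a : ℚ)⁻¹ := by
  obtain ⟨c, rfl⟩ : ∃ c, b = c + 1 := ⟨b - 1, by omega⟩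
  have h := Nat.choose_mul_succ_eq (a + c) a
  have h' : a + c + 1 - a = c + 1 := by omega
  rw [h'] at h
  have hq : ((a + c).choose a : ℚ) * (a + c + 1) = (a + (c + 1)).choose a * (c + 1) := by
    exact_mod_cast h
  have h₁ : ((a + c).choose a : ℚ) ≠ 0 := by
    exact_mod_cast (Nat.choose_pos (Nat.le_add_right a c)).ne'
  have h₂ : ((a + (c + 1)).choose a : ℚ) ≠ 0 := by
    exact_mod_cast (Nat.choose_pos (Nat.le_add_right a (c + 1))).ne'
  simp only [Nat.add_sub_cancel]
  field_simp
  push_cast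
  linarith

/-- Averaging over the points outside `A` of the weight of the pair `(A, B.erase x)` recovers the
weight of the pair `(A, B)`. -/
lemma sum_sdiff_inv_choose_card_erase {α : Type*} [DecidableEq α] {X A B : Finset α}
    (hA : A ⊆ X) (hB : B ⊆ X) (hAB : Disjoint A B) (hne : B.Nonempty) :
    ∑ x ∈ X \ A, ((A.card + (B.erase x).card).choose A.card : ℚ)⁻¹ =
      X.card * ((A.card + B.card).choose A.card : ℚ)⁻¹ := by
  have hBX : B ⊆ X \ A := Finset.subset_sdiff.2 ⟨hB, hAB.symm⟩
  rw [← Finset.sum_sdiff hBX]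
  have hout : ∑ x ∈ (X \ A) \ B, ((A.card + (B.erase x).card).choose A.card : ℚ)⁻¹ =
      ((X.card : ℚ) - A.card - B.card) * ((A.card + B.card).choose A.card : ℚ)⁻¹ := by
    rw [← Finset.cast_card_sdiff hA, ← Finset.cast_card_sdiff hBX, ← nsmul_eq_mul]
    refine Finset.sum_eq_card_nsmul fun x hx => ?_
    rw [Finset.erase_eq_of_notMem (Finset.mem_sdiff.1 hx).2]
  have hin : ∑ x ∈ B, ((A.card + (B.erase x).card).choose A.card : ℚ)⁻¹ =
      (A.card + B.card) * ((A.card + B.card).choose A.card : ℚ)⁻¹ := by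
    rw [← mul_inv_choose_add_pred _ _ hne.card_pos, ← nsmul_eq_mul]
    refine Finset.sum_eq_card_nsmul fun x hx => ?_
    rw [Finset.card_erase_of_mem hx]
  rw [hout, hin]
  ring

/-- **Bollobás's set-pairs inequality**. -/
theorem sum_inv_choose_le_one_of_cross_intersecting {ι α : Type*} [DecidableEq α]
    (A : ι → Finset α) (X : Finset α) (s : Finset ι) (B : ι → Finset α)
    (hA : ∀ i ∈ s, A i ⊆ X) (hB : ∀ i ∈ s, B i ⊆ X) (hAB : ∀ i ∈ s, Disjoint (A i) (B i))
    (hcross : ∀ i ∈ s, ∀ j ∈ s, i ≠ j → ¬ Disjoint (A i) (B j)) :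
    ∑ i ∈ s, (((A i).card + (B i).card).choose (A i).card : ℚ)⁻¹ ≤ 1 := by
  induction X using Finset.strongInduction generalizing s B with
  | H X ih =>
    rcases s.eq_empty_or_nonempty with rfl | ⟨k, hk⟩
    · simp
    by_cases hBne : ∀ i ∈ s, (B i).Nonempty
    · have hX : (0 : ℚ) < X.card := by
        exact_mod_cast ((hBne k hk).mono (hB k hk)).card_pos
      refine le_of_mul_le_mul_left ?_ hX
      calc (X.card : ℚ) * ∑ i ∈ s, (((A i).card + (B i).card).choose (A i).card : ℚ)⁻¹
          = ∑ i ∈ s, ∑ x ∈ X \ A i,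
              (((A i).card + ((B i).erase x).card).choose (A i).card : ℚ)⁻¹ := by
            rw [Finset.mul_sum]
            exact Finset.sum_congr rfl fun i hi => (sum_sdiff_inv_choose_card_erase
              (hA i hi) (hB i hi) (hAB i hi) (hBne i hi)).symm
        _ = ∑ x ∈ X, ∑ i ∈ s with x ∉ A i,
              (((A i).card + ((B i).erase x).card).choose (A i).card : ℚ)⁻¹ :=
            Finset.sum_comm' fun i x => by
              simp only [Finset.mem_sdiff, Finset.mem_filter]
              tauto
        _ ≤ ∑ x ∈ X, 1 := by
            refine Finset.sum_le_sum fun x hx => ih (X.erase x) (Finset.erase_ssubset hx) _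
              (fun i => (B i).erase x) ?_ ?_ ?_ ?_
            · intro i hi
              rw [Finset.mem_filter] at hi
              exact Finset.subset_erase.2 ⟨hA i hi.1, hi.2⟩
            · intro i hi
              exact Finset.erase_subset_erase x (hB i (Finset.mem_filter.1 hi).1)
            · intro i hi
              exact (hAB i (Finset.mem_filter.1 hi).1).mono_right (Finset.erase_subset x _)
            · intro i hi j hj hij hdisj
              rw [Finset.mem_filter] at hi hj
              refine hcross i hi.1 j hj.1 hij (Finset.disjoint_left.2 fun y hyA hyB => ?_)
              exact Finset.disjoint_left.1 hdisj hyA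
                (Finset.mem_erase.2 ⟨fun h => hi.2 (h ▸ hyA), hyB⟩)
        _ = X.card * 1 := by simp
    · push Not at hBne
      obtain ⟨j, hj, hBj⟩ := hBne
      have hs : s = {j} := Finset.eq_singleton_iff_unique_mem.2 ⟨hj, fun i hi => by
        by_contra hij
        exact hcross i hi j hj hij (by simp [hBj])⟩
      simp [hs, hBj]

lemma exists_isTransversal_card_eq_tau {V : Type*} [Fintype V] (G : SimpleGraph V) :
    ∃ S : Finset V, IsTransversal G ↑S ∧ S.card = tau G :=
  Nat.sInf_mem (s := {n | ∃ S : Finset V, IsTransversal G ↑S ∧ S.card = n})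
    ⟨_, Finset.univ, fun u _ _ => Or.inl (by simp), rfl⟩

lemma IsTransversal.tau_le_card {V : Type*} [Fintype V] {G : SimpleGraph V} {S : Finset V}
    (hS : IsTransversal G ↑S) : tau G ≤ S.card :=
  Nat.sInf_le ⟨S, hS, rfl⟩

/-- Every edge of a `τ`-critical graph is missed by a set of size `τ - 1` that meets all other
edges. -/
lemma TauCritical.exists_finset_missing_only {V : Type*} [Fintype V] [DecidableEq V]
    {G : SimpleGraph V} (hcrit : TauCritical G) {e : Sym2 V} (he : e ∈ G.edgeSet) :
    ∃ S : Finset V, S.card + 1 = tau G ∧ Disjoint e.toFinset S ∧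
      ∀ f ∈ G.edgeSet, f ≠ e → ¬ Disjoint f.toFinset S := by
  obtain ⟨S, hS, hcard⟩ := exists_isTransversal_card_eq_tau (G.deleteEdges {e})
  rw [hcrit.2 e he] at hcard
  have hmeet : ∀ f ∈ G.edgeSet, f ≠ e → ¬ Disjoint f.toFinset S := by
    intro f hf hfe hdisj
    induction f with
    | _ u v =>
      rw [Finset.disjoint_left] at hdisj
      have hadj : (G.deleteEdges {e}).Adj u v := by
        simpa [SimpleGraph.deleteEdges_adj] using ⟨hf, hfe⟩
      rcases hS hadj with h | h
      · exact hdisj (by simp) (Finset.mem_coe.1 h)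
      · exact hdisj (by simp) (Finset.mem_coe.1 h)
  have hpos : 0 < tau G := by
    obtain ⟨T, hT, hTcard⟩ := exists_isTransversal_card_eq_tau G
    rw [← hTcard, Finset.card_pos]
    induction e with
    | _ u v => exact (hT he).elim (fun h => ⟨u, h⟩) (fun h => ⟨v, h⟩)
  refine ⟨S, by omega, ?_, hmeet⟩
  by_contra hdisj
  have hSG : IsTransversal G ↑S := by
    intro u v huv
    have h : ¬ Disjoint (s(u, v)).toFinset S := by
      by_cases h : s(u, v) = e
      · rwa [h]
      · exact hmeet _ huv h
    obtain ⟨w, hw, hwS⟩ := Finset.not_disjoint_iff.1 h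
    rw [Sym2.mem_toFinset, Sym2.mem_iff] at hw
    rcases hw with rfl | rfl
    · exact Or.inl hwS
    · exact Or.inr hwS
  have := hSG.tau_le_card
  omega

theorem erdos_hajnal_moon_size_bound {V : Type*} [Fintype V] [DecidableEq V]
    (G : SimpleGraph V) [DecidableRel G.Adj] (t : ℕ)
    (hcrit : TauCritical G) (ht : tau G = t) :
    G.edgeFinset.card ≤ (t + 1).choose 2 := by
  choose! B hBcard hBdisj hBmeet using
    fun (e : Sym2 V) (he : e ∈ G.edgeSet) => hcrit.exists_finset_missing_only he
  have hsum := sum_inv_choose_le_one_of_cross_intersecting (fun e : Sym2 V => e.toFinset)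
    Finset.univ G.edgeFinset B (fun _ _ => Finset.subset_univ _)
    (fun _ _ => Finset.subset_univ _) (fun e he => hBdisj e (SimpleGraph.mem_edgeFinset.1 he))
    (fun e he f hf hef => hBmeet f (SimpleGraph.mem_edgeFinset.1 hf) e
      (SimpleGraph.mem_edgeFinset.1 he) hef)
  have hweight : ∀ e ∈ G.edgeFinset,
      ((e.toFinset.card + (B e).card).choose e.toFinset.card : ℚ)⁻¹ =
        ((t + 1).choose 2 : ℚ)⁻¹ := by
    intro e he
    rw [SimpleGraph.mem_edgeFinset] at he
    have hB := hBcard e he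
    rw [Sym2.card_toFinset_of_not_isDiag e (G.not_isDiag_of_mem_edgeSet he),
      show 2 + (B e).card = t + 1 by omega]
  rw [Finset.sum_congr rfl hweight, Finset.sum_const, nsmul_eq_mul] at hsum
  rcases G.edgeFinset.eq_empty_or_nonempty with hE | ⟨e, he⟩
  · simp [hE]
  have ht1 : 1 ≤ t := by
    have := hBcard e (SimpleGraph.mem_edgeFinset.1 he)
    omega
  have hpos : (0 : ℚ) < (t + 1).choose 2 := by
    exact_mod_cast Nat.choose_pos (by omega)
  rw [← div_eq_mul_inv, div_le_one hpos] at hsum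
  exact_mod_cast hsum
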